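/- For every α > 0 and every rectangle Π (i.e., every a < b and c > 0) there exists d₀ with 0 < d₀ < c, depending only on a, b, c and α, with the following property. Let f be harmonic on Π and continuous on the closure of Π, and let M > 0. Suppose: ∫_a^b max(f(x), 0) dx ≤ M; f(z) ≥ −M·(Im z)^{−α} for all z ∈ Π; and f(z) ≤ M for all z ∈ Π with Im z > d₀. Then for each δ with 0 < δ < (b − a)/2 there exists a constant C > 0, depending only on a, b, c, α, δ and M (not on f), such that ∫_{a+δ}^{b−δ} min(f(x), 0) dx ≥ −C. -/

import Mathlib

/-- The open rectangle `Π = {z : a < Re z < b, 0 < Im z < c}`. -/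
def rectangle (a b c : ℝ) : Set ℂ :=
  {z : ℂ | a < z.re ∧ z.re < b ∧ 0 < z.im ∧ z.im < c}

/-- `f : ℂ → ℝ` is harmonic on `s`: twice continuously differentiable with
`Δf = f_xx + f_yy = 0` on `s`. -/
def IsHarmonicOn (f : ℂ → ℝ) (s : Set ℂ) : Prop :=
  ContDiffOn ℝ 2 f s ∧
  ∀ z ∈ s, fderiv ℝ (fun w => fderiv ℝ f w 1) z 1 +
    fderiv ℝ (fun w => fderiv ℝ f w Complex.I) z Complex.I = 0

open Set Filter Topology MeasureTheory Metric InnerProductSpace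
open scoped Interval

lemma rectangle_eq_reProdIm (a b c : ℝ) : rectangle a b c = Ioo a b ×ℂ Ioo 0 c := by
  ext z
  simp [rectangle, Complex.mem_reProdIm, and_assoc]

lemma isOpen_rectangle (a b c : ℝ) : IsOpen (rectangle a b c) := by
  rw [rectangle_eq_reProdIm]
  exact isOpen_Ioo.reProdIm isOpen_Ioo

lemma add_mul_I_mem_rectangle {a b c x y : ℝ} :
    (x + y * Complex.I : ℂ) ∈ rectangle a b c ↔ x ∈ Ioo a b ∧ y ∈ Ioo 0 c := by
  simp [rectangle, and_assoc]

lemma add_mul_I_mem_closure_rectangle {a b c x y : ℝ} (hab : a < b) (hc : 0 < c) :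
    (x + y * Complex.I : ℂ) ∈ closure (rectangle a b c) ↔ x ∈ Icc a b ∧ y ∈ Icc 0 c := by
  rw [rectangle_eq_reProdIm, Complex.closure_reProdIm, closure_Ioo hab.ne, closure_Ioo hc.ne]
  simp [Complex.mem_reProdIm]

lemma IsHarmonicOn.harmonicOnNhd {f : ℂ → ℝ} {s : Set ℂ} (hs : IsOpen s)
    (hf : IsHarmonicOn f s) : HarmonicOnNhd f s := by
  intro z hz
  refine ⟨hf.1.contDiffAt (hs.mem_nhds hz), ?_⟩
  filter_upwards [hs.mem_nhds hz] with w hw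
  have hd : DifferentiableAt ℝ (fderiv ℝ f) w :=
    ((hf.1.contDiffAt (hs.mem_nhds hw)).fderiv_right (m := 1) (by norm_num)).differentiableAt
      (by norm_num)
  have key (v : ℂ) : fderiv ℝ (fun w => fderiv ℝ f w v) w v = fderiv ℝ (fderiv ℝ f) w v v := by
    rw [fderiv_clm_apply hd (differentiableAt_const v)]
    simp
  have h := hf.2 w hw
  rw [key, key] at h
  simpa [laplacian_eq_iteratedFDeriv_complexPlane, iteratedFDeriv_two_apply] using h

/-- **Harnack's inequality** on a disc. -/
lemma InnerProductSpace.HarmonicOnNhd.harnack_le {g : ℂ → ℝ} {z w : ℂ} {R : ℝ}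
    (hg : HarmonicOnNhd g (closedBall z R)) (hpos : ∀ u ∈ closedBall z R, 0 ≤ g u)
    (hw : w ∈ ball z R) : g w ≤ (R + ‖w - z‖) / (R - ‖w - z‖) * g z := by
  have hR : 0 < R := pos_of_mem_ball hw
  have hcont : ContinuousOn g (sphere z |R|) := by
    rw [abs_of_pos hR]
    exact hg.continuousOn.mono sphere_subset_closedBall
  have hmean : Real.circleAverage g z R = g z :=
    HarmonicOnNhd.circleAverage_eq (by rwa [abs_of_pos hR])
  rw [← hg.circleAverage_re_herglotzRieszKernel_smul hw, ← hmean, ← smul_eq_mul,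
    ← Real.circleAverage_smul]
  refine Real.circleAverage_mono ?_ (hcont.const_smul _).circleIntegrable' ?_
  · refine (ContinuousOn.smul ?_ hcont).circleIntegrable'
    exact Complex.continuous_re.comp_continuousOn (continuousOn_herglotzRieszKernel_sphere hw)
  · intro u hu
    rw [abs_of_pos hR] at hu
    simp only [Pi.smul_apply', Pi.smul_apply, smul_eq_mul, Function.comp_apply]
    exact mul_le_mul_of_nonneg_right (re_herglotzRieszKernel_le hu hw)
      (hpos u (sphere_subset_closedBall hu))

section SliceIntegrals

variable {a b c p q y : ℝ} {g : ℂ → ℝ} {ψ : ℝ → ℝ}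

lemma hasDerivAt_integral_slice (hap : a < p) (hpq : p ≤ q) (hqb : q < b)
    (hg : ContDiffOn ℝ 1 g (rectangle a b c)) (hψ : Continuous ψ) (hy : y ∈ Ioo 0 c) :
    HasDerivAt (fun t : ℝ => ∫ x in p..q, g (x + t * Complex.I) * ψ x)
      (∫ x in p..q, fderiv ℝ g (x + y * Complex.I) Complex.I * ψ x) y := by
  have hopen := isOpen_rectangle a b c
  have hIcc : Icc (y / 2) ((y + c) / 2) ⊆ Ioo 0 c := fun t ht =>
    ⟨by linarith [ht.1, hy.1], by linarith [ht.2, hy.2]⟩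
  have hmem : ∀ x ∈ Icc p q, ∀ t ∈ Ioo 0 c, (x + t * Complex.I : ℂ) ∈ rectangle a b c :=
    fun x hx t ht => add_mul_I_mem_rectangle.2
      ⟨⟨hap.trans_le hx.1, hx.2.trans_lt hqb⟩, ht⟩
  have hsub : Icc p q ×ℂ Icc (y / 2) ((y + c) / 2) ⊆ rectangle a b c := by
    intro z hz
    rw [Complex.mem_reProdIm] at hz
    rw [← Complex.re_add_im z]
    exact hmem _ hz.1 _ (hIcc hz.2)
  have hg' : ContinuousOn (fun z => fderiv ℝ g z Complex.I) (rectangle a b c) :=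
    (hg.continuousOn_fderiv_of_isOpen hopen le_rfl).clm_apply continuousOn_const
  have hline : ∀ {F : ℂ → ℝ}, ContinuousOn F (rectangle a b c) → ∀ t ∈ Ioo 0 c,
      ContinuousOn (fun x : ℝ => F (x + t * Complex.I) * ψ x) (uIcc p q) := by
    intro F hF t ht
    rw [uIcc_of_le hpq]
    exact (hF.comp (by fun_prop) fun x hx => hmem x hx t ht).mul hψ.continuousOn
  obtain ⟨B, hB⟩ := ((isCompact_Icc.reProdIm isCompact_Icc).exists_bound_of_continuousOn
    (hg'.mono hsub))
  obtain ⟨D, hD⟩ := (isCompact_Icc (a := p) (b := q)).exists_bound_of_continuousOn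
    hψ.continuousOn
  have hIoc : Ι p q ⊆ Icc p q := by
    rw [uIoc_of_le hpq]
    exact Ioc_subset_Icc_self
  have hnhds : Icc (y / 2) ((y + c) / 2) ∈ 𝓝 y :=
    Icc_mem_nhds (by linarith [hy.1]) (by linarith [hy.2])
  refine (intervalIntegral.hasDerivAt_integral_of_dominated_loc_of_deriv_le
    (F := fun (t x : ℝ) => g (x + t * Complex.I) * ψ x)
    (F' := fun (t x : ℝ) => fderiv ℝ g (x + t * Complex.I) Complex.I * ψ x)
    (bound := fun _ => B * D) hnhds ?_ ?_ ?_ ?_ ?_ ?_).2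
  · filter_upwards [hnhds] with t ht
    exact ((hline hg.continuousOn t (hIcc ht)).mono uIoc_subset_uIcc).aestronglyMeasurable
      measurableSet_uIoc
  · exact (hline hg.continuousOn y hy).intervalIntegrable
  · exact ((hline hg' y hy).mono uIoc_subset_uIcc).aestronglyMeasurable measurableSet_uIoc
  · refine ae_of_all _ fun x hx t ht => ?_
    rw [norm_mul]
    have h1 := hB (x + t * Complex.I) (by simpa [Complex.mem_reProdIm] using ⟨hIoc hx, ht⟩)
    exact mul_le_mul h1 (hD x (hIoc hx)) (norm_nonneg _) ((norm_nonneg _).trans h1)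
  · exact intervalIntegrable_const
  · refine ae_of_all _ fun x hx t ht => ?_
    have hz := hmem x (hIoc hx) t (hIcc ht)
    have h1 : HasFDerivAt g (fderiv ℝ g (x + t * Complex.I)) (x + t * Complex.I) :=
      ((hg.contDiffAt (hopen.mem_nhds hz)).differentiableAt (by norm_num)).hasFDerivAt
    have h2 : HasDerivAt (fun t : ℝ => (x + t * Complex.I : ℂ)) Complex.I t := by
      simpa using ((Complex.ofRealCLM.hasDerivAt (x := t)).mul_const Complex.I).const_add (x : ℂ)
    exact (h1.comp_hasDerivAt t h2).mul_const (ψ x)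

lemma integral_slice_fderiv_mul (hap : a < p) (hpq : p ≤ q) (hqb : q < b)
    (hg : ContDiffOn ℝ 1 g (rectangle a b c)) (hψ : ContDiff ℝ 1 ψ)
    (hp : ψ p = 0) (hq : ψ q = 0) (hy : y ∈ Ioo 0 c) :
    ∫ x in p..q, fderiv ℝ g (x + y * Complex.I) 1 * ψ x =
      -∫ x in p..q, g (x + y * Complex.I) * deriv ψ x := by
  have hopen := isOpen_rectangle a b c
  have hmem : ∀ x ∈ uIcc p q, (x + y * Complex.I : ℂ) ∈ rectangle a b c := by
    intro x hx
    rw [uIcc_of_le hpq] at hx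
    exact add_mul_I_mem_rectangle.2 ⟨⟨hap.trans_le hx.1, hx.2.trans_lt hqb⟩, hy⟩
  have hg' : ContinuousOn (fun z => fderiv ℝ g z 1) (rectangle a b c) :=
    (hg.continuousOn_fderiv_of_isOpen hopen le_rfl).clm_apply continuousOn_const
  have h := intervalIntegral.integral_mul_deriv_eq_deriv_mul
    (u := fun x : ℝ => g (x + y * Complex.I)) (v := ψ)
    (u' := fun x : ℝ => fderiv ℝ g (x + y * Complex.I) 1) (v' := deriv ψ) (a := p) (b := q)
    (fun x hx => ?_) (fun x _ => (hψ.differentiable (by norm_num) x).hasDerivAt)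
    (hg'.comp (by fun_prop) hmem).intervalIntegrable
    ((hψ.continuous_deriv le_rfl).intervalIntegrable _ _)
  · rw [hp, hq] at h
    linarith
  · have h1 : HasFDerivAt g (fderiv ℝ g (x + y * Complex.I)) (x + y * Complex.I) :=
      ((hg.contDiffAt (hopen.mem_nhds (hmem x hx))).differentiableAt (by norm_num)).hasFDerivAt
    have h2 : HasDerivAt (fun t : ℝ => (t + y * Complex.I : ℂ)) 1 x := by
      simpa using (Complex.ofRealCLM.hasDerivAt (x := x)).add_const (y * Complex.I)
    exact h1.comp_hasDerivAt x h2

/-- Integrating a harmonic function against a test function in `x` gives a function of `y` whose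
second derivative is minus the integral against the second derivative of the test function. -/
lemma IsHarmonicOn.hasDerivAt_hasDerivAt_integral_slice (hap : a < p) (hpq : p ≤ q) (hqb : q < b)
    (hg : IsHarmonicOn g (rectangle a b c)) (hψ : ContDiff ℝ 2 ψ)
    (hp : ψ p = 0) (hq : ψ q = 0) (hp' : deriv ψ p = 0) (hq' : deriv ψ q = 0) :
    ∃ v : ℝ → ℝ, ∀ y ∈ Ioo 0 c,
      HasDerivAt (fun t : ℝ => ∫ x in p..q, g (x + t * Complex.I) * ψ x) (v y) y ∧
      HasDerivAt v (-∫ x in p..q, g (x + y * Complex.I) * deriv (deriv ψ) x) y := by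
  have hopen := isOpen_rectangle a b c
  have h1 : ContDiffOn ℝ 1 g (rectangle a b c) := hg.1.of_le (by norm_num)
  have hd (v : ℂ) : ContDiffOn ℝ 1 (fun w => fderiv ℝ g w v) (rectangle a b c) :=
    (hg.1.fderiv_of_isOpen hopen (by norm_num)).clm_apply contDiffOn_const
  have hψ1 : ContDiff ℝ 1 (deriv ψ) := by
    have : ContDiff ℝ (1 + 1) ψ := by simpa [one_add_one_eq_two] using hψ
    exact (contDiff_succ_iff_deriv.1 this).2.2
  refine ⟨fun t => ∫ x in p..q, fderiv ℝ g (x + t * Complex.I) Complex.I * ψ x, fun y hy =>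
    ⟨hasDerivAt_integral_slice hap hpq hqb h1 hψ.continuous hy, ?_⟩⟩
  convert hasDerivAt_integral_slice hap hpq hqb (hd Complex.I) hψ.continuous hy using 1
  have e1 := integral_slice_fderiv_mul hap hpq hqb h1 hψ1 hp' hq' hy
  have e2 := integral_slice_fderiv_mul hap hpq hqb (hd 1) (hψ.of_le (by norm_num)) hp hq hy
  rw [← e1, ← neg_eq_iff_eq_neg.2 e2, ← intervalIntegral.integral_neg]
  refine intervalIntegral.integral_congr fun x hx => ?_
  rw [uIcc_of_le hpq] at hx
  have := hg.2 (x + y * Complex.I)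
    (add_mul_I_mem_rectangle.2 ⟨⟨hap.trans_le hx.1, hx.2.trans_lt hqb⟩, hy⟩)
  rw [← neg_mul, neg_eq_of_add_eq_zero_right this]

end SliceIntegrals

/-- A lower bound for a function on `(0, c / 2]` from a lower bound for its second derivative that
is singular at `0`. -/
lemma exists_le_of_le_deriv_deriv {c A B e : ℝ} (hc : 0 < c) (hA : 0 ≤ A)
    (he : e * (e - 1) ≠ 0) :
    ∃ C : ℝ, ∀ u v w : ℝ → ℝ, (∀ y ∈ Ioo 0 c, HasDerivAt u (v y) y) →
      (∀ y ∈ Ioo 0 c, HasDerivAt v (w y) y) →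
      (∀ y ∈ Ioo 0 c, -(A * (1 + y ^ (e - 2))) ≤ w y) →
      (∀ y ∈ Ico (c / 2) c, |u y| ≤ B) →
      ∀ y ∈ Ioo 0 (c / 2), -(C * (1 + y ^ e)) ≤ u y := by
  set D := c ^ 2 / 2 + |1 / (e * (e - 1))| with hD
  set g : ℝ → ℝ := fun y => y ^ 2 / 2 + y ^ e / (e * (e - 1)) with hg
  have hgD : ∀ y ∈ Ioo 0 c, |g y| ≤ D * (1 + y ^ e) := by
    intro y hy
    have h0 := Real.rpow_pos_of_pos hy.1 e
    have h1 : y ^ 2 ≤ c ^ 2 := pow_le_pow_left₀ hy.1.le hy.2.le 2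
    have h2 := abs_nonneg (1 / (e * (e - 1)))
    simp only [hg, hD]
    rw [div_eq_mul_one_div (y ^ e)]
    refine (abs_add_le _ _).trans ?_
    rw [abs_mul, abs_of_pos h0, abs_of_nonneg (by positivity : 0 ≤ y ^ 2 / 2)]
    nlinarith [mul_nonneg (sq_nonneg c) h0.le]
  set B' := B + A * (D * (1 + (c / 2) ^ e) + D * (1 + (3 * c / 4) ^ e)) with hB'
  refine ⟨5 * |B'| + A * D, fun u v w hu hv hw hB y hy => ?_⟩
  set G : ℝ → ℝ := fun y => u y + A * g y with hG
  have hg1 : ∀ y ∈ Ioo 0 c, HasDerivAt g (y + y ^ (e - 1) / (e - 1)) y := by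
    intro y hy
    have h1 := ((hasDerivAt_id' y).pow 2).div_const 2
    have h2 := (Real.hasDerivAt_rpow_const (p := e) (Or.inl hy.1.ne')).div_const (e * (e - 1))
    refine (h1.add h2).congr_deriv ?_
    have h3 : e ≠ 0 := left_ne_zero_of_mul he
    have h4 : e - 1 ≠ 0 := right_ne_zero_of_mul he
    field_simp
    ring
  have hg2 : ∀ y ∈ Ioo 0 c, HasDerivAt (fun y => y + y ^ (e - 1) / (e - 1))
      (1 + y ^ (e - 2)) y := by
    intro y hy
    have h2 := (Real.hasDerivAt_rpow_const (p := e - 1) (Or.inl hy.1.ne')).div_const (e - 1)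
    refine ((hasDerivAt_id' y).add h2).congr_deriv ?_
    have h3 : e - 1 ≠ 0 := right_ne_zero_of_mul he
    rw [show e - 1 - 1 = e - 2 by ring]
    field_simp
  have hG1 : ∀ y ∈ Ioo 0 c, HasDerivAt G (v y + A * (y + y ^ (e - 1) / (e - 1))) y :=
    fun y hy => (hu y hy).add ((hg1 y hy).const_mul A)
  have hG2 : ∀ y ∈ Ioo 0 c, HasDerivAt (deriv G) (w y + A * (1 + y ^ (e - 2))) y := by
    intro y hy
    refine ((hv y hy).add ((hg2 y hy).const_mul A)).congr_of_eventuallyEq ?_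
    filter_upwards [isOpen_Ioo.mem_nhds hy] with t ht using (hG1 t ht).deriv
  have hconv : ConvexOn ℝ (Ioo 0 c) G := by
    refine convexOn_of_deriv2_nonneg' (convex_Ioo _ _)
      (fun y hy => (hG1 y hy).differentiableAt.differentiableWithinAt)
      (fun y hy => (hG2 y hy).differentiableAt.differentiableWithinAt) fun y hy => ?_
    simp only [Function.iterate_succ, Function.iterate_zero, Function.comp_apply, id]
    rw [(hG2 y hy).deriv]
    linarith [hw y hy]
  have hm1 : c / 2 ∈ Ioo 0 c := ⟨by linarith, by linarith⟩
  have hm2 : 3 * c / 4 ∈ Ioo 0 c := ⟨by linarith, by linarith⟩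
  have hy' : y ∈ Ioo 0 c := ⟨hy.1, by linarith [hy.2]⟩
  have hGle1 : -B' ≤ G (c / 2) := by
    have h1 := abs_le.1 (hB (c / 2) ⟨le_rfl, hm1.2⟩)
    have h2 := mul_le_mul_of_nonneg_left (neg_le_of_abs_le (hgD _ hm1)) hA
    have h4 := mul_nonneg hA ((abs_nonneg _).trans (hgD _ hm2))
    simp only [hG, hB']
    linarith [h1.1]
  have hGle2 : G (3 * c / 4) ≤ B' := by
    have h1 := abs_le.1 (hB (3 * c / 4) ⟨by linarith, hm2.2⟩)
    have h2 := mul_le_mul_of_nonneg_left (le_of_abs_le (hgD _ hm2)) hA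
    have h3 := mul_nonneg hA ((abs_nonneg _).trans (hgD _ hm1))
    simp only [hG, hB']
    linarith [h1.2]
  have hslope := hconv.slope_mono_adjacent hy' hm2 hy.2 (show c / 2 < 3 * c / 4 by linarith)
  rw [div_le_div_iff₀ (by linarith [hy.2]) (by linarith)] at hslope
  have hGy : -(5 * |B'|) ≤ G y := by
    have hb := le_abs_self B'
    have hb0 := abs_nonneg B'
    have h1 : (G (3 * c / 4) - G (c / 2)) * (c / 2 - y) ≤ (2 * |B'|) * (c / 2) :=
      mul_le_mul (by linarith) (by linarith [hy.1]) (by linarith [hy.2]) (by linarith)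
    have h2 : (G (c / 2) - G y) * (c / 4) ≤ (4 * |B'|) * (c / 4) := by linarith
    have h3 := le_of_mul_le_mul_right h2 (by linarith)
    linarith
  have h0 := Real.rpow_pos_of_pos hy.1 e
  have h1 := mul_le_mul_of_nonneg_left (le_of_abs_le (hgD _ hy')) hA
  have h2 := mul_nonneg (abs_nonneg B') h0.le
  simp only [hG] at hGy
  nlinarith

/-- Integrating twice improves the order of a power singularity at `0` by two. -/
lemma exists_abs_le_of_abs_deriv_deriv_le {c A B e : ℝ} (hc : 0 < c) (hA : 0 ≤ A)
    (he : e * (e - 1) ≠ 0) :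
    ∃ C : ℝ, 0 ≤ C ∧ ∀ u v w : ℝ → ℝ, (∀ y ∈ Ioo 0 c, HasDerivAt u (v y) y) →
      (∀ y ∈ Ioo 0 c, HasDerivAt v (w y) y) →
      (∀ y ∈ Ioo 0 c, |w y| ≤ A * (1 + y ^ (e - 2))) →
      (∀ y ∈ Ico (c / 2) c, |u y| ≤ B) →
      ∀ y ∈ Ioo 0 c, |u y| ≤ C * (1 + y ^ e) := by
  obtain ⟨C, hC⟩ := exists_le_of_le_deriv_deriv (B := B) hc hA he
  refine ⟨max |B| C, (abs_nonneg B).trans (le_max_left _ _), fun u v w hu hv hw hB y hy => ?_⟩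
  have h0 := Real.rpow_pos_of_pos hy.1 e
  rcases lt_or_ge y (c / 2) with h | h
  · have h1 := hC u v w hu hv (fun y hy => (abs_le.1 (hw y hy)).1) hB y ⟨hy.1, h⟩
    have h2 := hC (-u) (-v) (-w) (fun y hy => (hu y hy).neg) (fun y hy => (hv y hy).neg)
      (fun y hy => by simpa using (abs_le.1 (hw y hy)).2) (by simpa using hB) y ⟨hy.1, h⟩
    simp only [Pi.neg_apply] at h2
    have h3 : C * (1 + y ^ e) ≤ max |B| C * (1 + y ^ e) := by gcongr; exact le_max_right _ _
    exact abs_le.2 ⟨by linarith, by linarith⟩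
  · have h1 : |B| ≤ max |B| C * (1 + y ^ e) := by
      nlinarith [le_max_left |B| C, abs_nonneg B]
    exact (hB y ⟨h, hy.2⟩).trans ((le_abs_self B).trans h1)

/-- A harmonic function on a rectangle which is bounded above on the upper half and has a power
lower bound also has a power upper bound, away from the vertical sides. -/
lemma exists_abs_le_rpow {a b c α M p q : ℝ} (hc : 0 < c) (hM : 0 < M)
    (hap : a < p) (hqb : q < b) :
    ∃ N : ℕ, 1 ≤ N ∧ ∃ K : ℝ, 0 ≤ K ∧ ∀ f : ℂ → ℝ, IsHarmonicOn f (rectangle a b c) →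
      (∀ z ∈ rectangle a b c, -(M * z.im ^ (-α)) ≤ f z) →
      (∀ z ∈ rectangle a b c, c / 2 < z.im → f z ≤ M) →
      0 < α → ∀ x ∈ Icc p q, ∀ y ∈ Ioo 0 c,
        |f (x + y * Complex.I)| ≤ K * (1 + y ^ (1 / 2 - 2 * N : ℝ)) := by
  obtain ⟨θ, hθ0, hθ4, hθp, hθq⟩ : ∃ θ : ℝ, 0 < θ ∧ θ ≤ 1 / 4 ∧ θ * c ≤ p - a ∧
      θ * c ≤ b - q := by
    refine ⟨min (1 / 4) (min ((p - a) / c) ((b - q) / c)), ?_, min_le_left _ _, ?_, ?_⟩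
    · have := div_pos (sub_pos.2 hap) hc
      have := div_pos (sub_pos.2 hqb) hc
      positivity
    · rw [← le_div_iff₀ hc]
      exact (min_le_right _ _).trans (min_le_left _ _)
    · rw [← le_div_iff₀ hc]
      exact (min_le_right _ _).trans (min_le_right _ _)
  set r := 1 - θ / 2 with hr
  have hr0 : 7 / 8 ≤ r := by linarith
  have hr1 : r < 1 := by linarith
  obtain ⟨n₀, hn₀⟩ := exists_pow_lt_of_lt_one (show (0 : ℝ) < 1 / 6 by norm_num) hr1
  obtain ⟨N, hN1, hNα, hNn⟩ : ∃ N : ℕ, 1 ≤ N ∧ α ≤ 2 * N - 1 / 2 ∧ (n₀ : ℝ) ≤ 2 * N - 1 / 2 := by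
    refine ⟨n₀ + ⌈α⌉₊ + 1, by omega, ?_, ?_⟩ <;> push_cast <;>
      linarith [Nat.le_ceil α, Nat.cast_nonneg (α := ℝ) n₀, Nat.cast_nonneg (α := ℝ) ⌈α⌉₊]
  set k : ℝ := 2 * N - 1 / 2 with hk
  have hk0 : 0 < k := by
    have : (1 : ℝ) ≤ N := by exact_mod_cast hN1
    linarith
  have hrk : r ^ k ≤ 1 / 6 := by
    refine le_trans ?_ hn₀.le
    rw [← Real.rpow_natCast]
    exact Real.rpow_le_rpow_of_exponent_ge (by linarith) hr1.le hNn
  set K₁ := M * c ^ k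
  set K₂ := M * 2 ^ α * c ^ (k - α)
  have hK₁ : 0 < K₁ := by positivity
  have hK₂ : 0 < K₂ := by positivity
  refine ⟨N, hN1, K₁ + 4 * K₂ + M, by positivity, fun f hf hlow hup hα x hx y hy => ?_⟩
  rw [show (1 / 2 - 2 * N : ℝ) = -k by ring]
  have hmem : ∀ x ∈ Icc p q, ∀ y ∈ Ioo 0 c, (x + y * Complex.I : ℂ) ∈ rectangle a b c :=
    fun x hx y hy => add_mul_I_mem_rectangle.2 ⟨⟨hap.trans_le hx.1, hx.2.trans_lt hqb⟩, hy⟩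
  have hbase : ∀ x ∈ Icc p q, ∀ y ∈ Ioo 0 c, c / 2 < y →
      f (x + y * Complex.I) ≤ (K₁ + 4 * K₂) * y ^ (-k) := by
    intro x hx y hy hcy
    have h1 := hup _ (hmem x hx y hy) (by simpa using hcy)
    have h2 : 1 ≤ c ^ k * y ^ (-k) := by
      rw [Real.rpow_neg hy.1.le, ← div_eq_mul_inv, one_le_div (Real.rpow_pos_of_pos hy.1 k)]
      exact Real.rpow_le_rpow hy.1.le hy.2.le hk0.le
    have h3 := mul_pos hK₂ (Real.rpow_pos_of_pos hy.1 (-k))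
    calc f (x + y * Complex.I) ≤ M * 1 := by linarith
      _ ≤ M * (c ^ k * y ^ (-k)) := by gcongr
      _ = K₁ * y ^ (-k) := by ring
      _ ≤ (K₁ + 4 * K₂) * y ^ (-k) := by linarith
  have hupper : ∀ n : ℕ, ∀ x ∈ Icc p q, ∀ y ∈ Ioo 0 c, r ^ n * (c / 2) < y →
      f (x + y * Complex.I) ≤ (K₁ + 4 * K₂) * y ^ (-k) := by
    intro n
    induction n with
    | zero => simpa using hbase
    | succ n ih =>
      intro x hx y hy hny
      rcases lt_or_ge (c / 2) y with hcy | hcy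
      · exact hbase x hx y hy hcy
      have hrpos : 0 < r := by linarith
      obtain ⟨Y, hYy⟩ : ∃ Y, y = r * Y := ⟨y / r, by field_simp⟩
      have hY0 : 0 < Y := by
        have := hy.1
        rw [hYy] at this
        exact pos_of_mul_pos_right this hrpos.le
      have hYn : r ^ n * (c / 2) < Y := by
        rw [hYy, pow_succ'] at hny
        exact lt_of_mul_lt_mul_left (by linarith) hrpos.le
      have hYc : Y ≤ 4 * c / 7 := by nlinarith
      have hYmem : Y ∈ Ioo 0 c := ⟨hY0, by linarith⟩
      have hyY : y ≤ Y := by nlinarith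
      have hθY : θ * Y ≤ Y / 4 := by nlinarith
      set z : ℂ := x + Y * Complex.I with hz
      have hball : ∀ u ∈ closedBall z (θ * Y), u ∈ rectangle a b c ∧ y / 2 ≤ u.im := by
        intro u hu
        rw [mem_closedBall, dist_eq_norm] at hu
        have h1 := abs_le.1 ((Complex.abs_re_le_norm (u - z)).trans hu)
        have h2 := abs_le.1 ((Complex.abs_im_le_norm (u - z)).trans hu)
        simp [hz] at h1 h2
        have h3 : θ * Y < θ * c := by nlinarith [hYmem.2]
        exact ⟨⟨by linarith [hx.1], by linarith [hx.2], by linarith, by linarith⟩, by linarith⟩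
      set m := M * (y / 2) ^ (-α) with hm
      have hm0 : 0 < m := by have := hy.1; positivity
      have hharm : HarmonicOnNhd (f + fun _ => m) (closedBall z (θ * Y)) :=
        HarmonicOnNhd.add ((hf.harmonicOnNhd (isOpen_rectangle a b c)).mono
          fun u hu => (hball u hu).1) (harmonicOnNhd_const m)
      have hpos : ∀ u ∈ closedBall z (θ * Y), 0 ≤ f u + m := by
        intro u hu
        have h1 := hlow u (hball u hu).1
        have h2 : u.im ^ (-α) ≤ (y / 2) ^ (-α) :=
          Real.rpow_le_rpow_of_nonpos (by linarith [hy.1]) (hball u hu).2 (by linarith)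
        have h3 := mul_le_mul_of_nonneg_left h2 hM.le
        linarith
      have hnorm : ‖(x + y * Complex.I : ℂ) - z‖ = θ * Y / 2 := by
        have : (x + y * Complex.I : ℂ) - z = ((y - Y : ℝ) : ℂ) * Complex.I := by
          rw [hz]; push_cast; ring
        rw [this, norm_mul, Complex.norm_I, mul_one, Complex.norm_real, Real.norm_eq_abs,
          abs_of_nonpos (by linarith), hYy, hr]
        ring
      have hθY0 : 0 < θ * Y := by positivity
      have hH := hharm.harnack_le hpos (w := x + y * Complex.I)
        (by rw [mem_ball, dist_eq_norm, hnorm]; linarith)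
      rw [hnorm, show (θ * Y + θ * Y / 2) / (θ * Y - θ * Y / 2) = 3 by field_simp; norm_num] at hH
      simp only [Pi.add_apply] at hH
      have hIH := ih x hx Y hYmem hYn
      have hYk : Y ^ (-k) ≤ 1 / 6 * y ^ (-k) := by
        rw [hYy, Real.mul_rpow hrpos.le hY0.le, ← mul_assoc]
        have h1 : 1 ≤ 1 / 6 * r ^ (-k) := by
          rw [Real.rpow_neg hrpos.le, ← div_eq_mul_inv, one_le_div (Real.rpow_pos_of_pos hrpos k)]
          exact hrk
        exact le_mul_of_one_le_left (Real.rpow_nonneg hY0.le _) h1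
      have hmk : m ≤ K₂ * y ^ (-k) := by
        have h1 : y ^ (k - α) ≤ c ^ (k - α) :=
          Real.rpow_le_rpow hy.1.le hy.2.le (by linarith)
        have h2 : (y / 2) ^ (-α) = 2 ^ α * (y ^ (k - α) * y ^ (-k)) := by
          rw [← Real.rpow_add hy.1, Real.div_rpow hy.1.le (by norm_num),
            Real.rpow_neg (by norm_num : (0 : ℝ) ≤ 2), div_inv_eq_mul, mul_comm]
          congr 2
          ring
        have h3 := Real.rpow_pos_of_pos hy.1 (-k)
        rw [hm, h2]
        calc M * (2 ^ α * (y ^ (k - α) * y ^ (-k)))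
            ≤ M * (2 ^ α * (c ^ (k - α) * y ^ (-k))) := by gcongr
          _ = K₂ * y ^ (-k) := by ring
      have h1 := mul_le_mul_of_nonneg_left hYk (by positivity : 0 ≤ K₁ + 4 * K₂)
      have h2 := mul_pos hK₁ (Real.rpow_pos_of_pos hy.1 (-k))
      linarith
  have hyk := Real.rpow_pos_of_pos hy.1 (-k)
  have h0 : (K₁ + 4 * K₂) * y ^ (-k) ≤ (K₁ + 4 * K₂ + M) * (1 + y ^ (-k)) := by
    have := mul_pos hM hyk
    linarith
  rw [abs_le]
  constructor
  · have h1 := hlow _ (hmem x hx y hy)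
    have h2 : y ^ (-α) ≤ 1 + y ^ (-k) := by
      rcases le_total y 1 with h | h
      · linarith [Real.rpow_le_rpow_of_exponent_ge hy.1 h (neg_le_neg hNα)]
      · linarith [Real.rpow_le_one_of_one_le_of_nonpos h (neg_nonpos.2 hα.le)]
    have h3 := mul_le_mul_of_nonneg_left h2 hM.le
    have h4 : 0 ≤ (K₁ + 4 * K₂) * (1 + y ^ (-k)) := by positivity
    simp at h1
    linarith
  · obtain ⟨n, hn⟩ := exists_pow_lt_of_lt_one (div_pos hy.1 (by positivity : 0 < c / 2)) hr1
    rw [lt_div_iff₀ (by positivity)] at hn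
    exact (hupper n x hx y hy hn).trans h0

lemma exists_abs_integral_slice_le {a b c p q K : ℝ} {N : ℕ} (hc : 0 < c) (hap : a < p)
    (hpq : p ≤ q) (hqb : q < b) (hN : 1 ≤ N) (hK : 0 ≤ K) (j : ℕ) :
    ∀ m : ℕ, m + j = N → ∀ ψ : ℝ → ℝ, ContDiff ℝ (⊤ : ℕ∞) ψ → tsupport ψ ⊆ Ioo p q →
      ∃ C : ℝ, 0 ≤ C ∧ ∀ f : ℂ → ℝ, IsHarmonicOn f (rectangle a b c) →
        (∀ x ∈ Icc p q, ∀ y ∈ Ioo 0 c,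
          |f (x + y * Complex.I)| ≤ K * (1 + y ^ (1 / 2 - 2 * N : ℝ))) →
        ∀ y ∈ Ioo 0 c, |∫ x in p..q, f (x + y * Complex.I) * ψ x| ≤
          C * (1 + y ^ (1 / 2 - 2 * m : ℝ)) := by
  induction j with
  | zero =>
    rintro m rfl ψ hψ -
    obtain ⟨S, hS⟩ := (isCompact_Icc (a := p) (b := q)).exists_bound_of_continuousOn
      hψ.continuous.continuousOn
    refine ⟨K * |S| * (q - p), by have := sub_nonneg.2 hpq; positivity, fun f _ hb y hy => ?_⟩
    have h0 := Real.rpow_pos_of_pos hy.1 (1 / 2 - 2 * (m + 0 : ℕ) : ℝ)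
    have := intervalIntegral.norm_integral_le_of_norm_le_const (a := p) (b := q)
      (f := fun x : ℝ => f (x + y * Complex.I) * ψ x)
      (C := K * (1 + y ^ (1 / 2 - 2 * (m + 0 : ℕ) : ℝ)) * |S|) fun x hx => by
        rw [uIoc_of_le hpq] at hx
        have hx' := Ioc_subset_Icc_self hx
        rw [norm_mul]
        exact mul_le_mul (hb x hx' y hy) ((hS x hx').trans (le_abs_self S)) (norm_nonneg _)
          (by positivity)
    rw [abs_of_nonneg (sub_nonneg.2 hpq), Real.norm_eq_abs] at this
    exact this.trans_eq (by rw [Nat.add_zero]; ring)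
  | succ j ih =>
    intro m hm ψ hψ hsupp
    have hψ' : ContDiff ℝ (⊤ : ℕ∞) (deriv ψ) := (contDiff_infty_iff_deriv.1 hψ).2
    have hψ'' : ContDiff ℝ (⊤ : ℕ∞) (deriv (deriv ψ)) := (contDiff_infty_iff_deriv.1 hψ').2
    have hsupp' : tsupport (deriv ψ) ⊆ Ioo p q := (tsupport_deriv_subset).trans hsupp
    have hsupp'' : tsupport (deriv (deriv ψ)) ⊆ Ioo p q := (tsupport_deriv_subset).trans hsupp'
    have hvan : ∀ {φ : ℝ → ℝ}, tsupport φ ⊆ Ioo p q → φ p = 0 ∧ φ q = 0 := fun h =>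
      ⟨image_eq_zero_of_notMem_tsupport fun hp => lt_irrefl _ (h hp).1,
        image_eq_zero_of_notMem_tsupport fun hq => lt_irrefl _ (h hq).2⟩
    obtain ⟨A, hA, hA'⟩ := ih (m + 1) (by omega) _ hψ'' hsupp''
    obtain ⟨S, hS⟩ := (isCompact_Icc (a := p) (b := q)).exists_bound_of_continuousOn
      hψ.continuous.continuousOn
    have hexp1 : (1 / 2 - 2 * m : ℝ) ≠ 0 := by
      intro h
      have : (4 * m : ℝ) = 1 := by linarith
      norm_cast at this
      omega
    have hexp2 : (1 / 2 - 2 * m - 1 : ℝ) ≠ 0 := by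
      have := Nat.cast_nonneg (α := ℝ) m
      intro h
      linarith
    obtain ⟨C, hC, hC'⟩ := exists_abs_le_of_abs_deriv_deriv_le (e := 1 / 2 - 2 * (m : ℝ))
      (B := K * (1 + (c / 2) ^ (1 / 2 - 2 * N : ℝ)) * |S| * |q - p|) hc hA
      (mul_ne_zero hexp1 hexp2)
    refine ⟨C, hC, fun f hf hb => ?_⟩
    obtain ⟨v, hv⟩ := hf.hasDerivAt_hasDerivAt_integral_slice hap hpq hqb
      (contDiff_infty.1 hψ 2) (hvan hsupp).1 (hvan hsupp).2 (hvan hsupp').1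
      (hvan hsupp').2
    refine hC' _ v _ (fun y hy => (hv y hy).1) (fun y hy => (hv y hy).2) (fun y hy => ?_)
      fun y hy => ?_
    · rw [abs_neg]
      convert hA' f hf hb y hy using 4
      push_cast
      ring
    · refine intervalIntegral.norm_integral_le_of_norm_le_const
        (f := fun x : ℝ => f (x + y * Complex.I) * ψ x) fun x hx => ?_
      rw [uIoc_of_le hpq] at hx
      have hx' := Ioc_subset_Icc_self hx
      have hc2 : 0 < c / 2 := by positivity
      have hy0 : 0 < y := hc2.trans_le hy.1
      have hN' : (1 : ℝ) ≤ N := by exact_mod_cast hN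
      have h1 : y ^ (1 / 2 - 2 * N : ℝ) ≤ (c / 2) ^ (1 / 2 - 2 * N : ℝ) :=
        Real.rpow_le_rpow_of_nonpos hc2 hy.1 (by linarith)
      have h2 := hb x hx' y ⟨hy0, hy.2⟩
      rw [norm_mul]
      refine mul_le_mul (h2.trans ?_) ((hS x hx').trans (le_abs_self S)) (norm_nonneg _)
        (by positivity)
      gcongr

lemma tendsto_integral_slice {a b c p q : ℝ} {f : ℂ → ℝ} {ψ : ℝ → ℝ} (hab : a < b) (hc : 0 < c)
    (hap : a ≤ p) (hpq : p ≤ q) (hqb : q ≤ b) (hf : ContinuousOn f (closure (rectangle a b c)))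
    (hψ : Continuous ψ) :
    Tendsto (fun y : ℝ => ∫ x in p..q, f (x + y * Complex.I) * ψ x) (𝓝[>] 0)
      (𝓝 (∫ x in p..q, f x * ψ x)) := by
  have hmem : ∀ x ∈ Icc p q, ∀ t ∈ Icc 0 c, (x + t * Complex.I : ℂ) ∈ closure (rectangle a b c) :=
    fun x hx t ht => (add_mul_I_mem_closure_rectangle hab hc).2
      ⟨⟨hap.trans hx.1, hx.2.trans hqb⟩, ht⟩
  have hcomp : IsCompact (closure (rectangle a b c)) := by
    rw [rectangle_eq_reProdIm, Complex.closure_reProdIm, closure_Ioo hab.ne, closure_Ioo hc.ne]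
    exact isCompact_Icc.reProdIm isCompact_Icc
  obtain ⟨B, hB⟩ := hcomp.exists_bound_of_continuousOn hf
  obtain ⟨S, hS⟩ := (isCompact_Icc (a := p) (b := q)).exists_bound_of_continuousOn
    hψ.continuousOn
  have hIoc : Ι p q ⊆ Icc p q := by
    rw [uIoc_of_le hpq]
    exact Ioc_subset_Icc_self
  have hev : ∀ᶠ t : ℝ in 𝓝[>] 0, t ∈ Icc 0 c := by
    filter_upwards [Ioo_mem_nhdsGT hc] with t ht using Ioo_subset_Icc_self ht
  refine intervalIntegral.tendsto_integral_filter_of_dominated_convergence (fun _ => B * S)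
    ?_ ?_ intervalIntegrable_const ?_
  · filter_upwards [hev] with t ht
    exact ((hf.comp (by fun_prop) fun x hx => hmem x (hIoc hx) t ht).mul
      hψ.continuousOn).aestronglyMeasurable measurableSet_uIoc
  · filter_upwards [hev] with t ht
    refine ae_of_all _ fun x hx => ?_
    have h1 := hB _ (hmem x (hIoc hx) t ht)
    rw [norm_mul]
    exact mul_le_mul h1 (hS x (hIoc hx)) (norm_nonneg _) ((norm_nonneg _).trans h1)
  · refine ae_of_all _ fun x hx => Tendsto.mul_const _ ?_
    have h0 := hf _ (hmem x (hIoc hx) 0 ⟨le_rfl, hc.le⟩)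
    have h1 : Tendsto (fun t : ℝ => (x + t * Complex.I : ℂ)) (𝓝[>] 0)
        (𝓝[closure (rectangle a b c)] (x + (0 : ℝ) * Complex.I)) := by
      refine tendsto_nhdsWithin_iff.2 ⟨?_, ?_⟩
      · exact (Continuous.tendsto (by fun_prop) (0 : ℝ)).mono_left nhdsWithin_le_nhds
      · filter_upwards [hev] with t ht using hmem x (hIoc hx) t ht
    simpa [Function.comp_def] using h0.tendsto.comp h1

/-- there is a height `d₀ = d₀(a, b, c, α) ∈ (0, c)` such that any
harmonic `f` on `Π`, continuous on the closure, with `∫_a^b f⁺ ≤ M`,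
`f(z) ≥ −M (Im z)^{−α}` on `Π`, and `f ≤ M` above height `d₀`, satisfies
`∫_{a+δ}^{b−δ} f⁻ ≥ −C` with `C = C(a, b, c, α, δ, M)`. -/
theorem statement16 (a b c α : ℝ) (hab : a < b) (hc : 0 < c) (hα : 0 < α) :
    ∃ d₀ : ℝ, 0 < d₀ ∧ d₀ < c ∧
      ∀ M : ℝ, 0 < M → ∀ δ : ℝ, 0 < δ → δ < (b - a) / 2 →
        ∃ C > (0 : ℝ), ∀ f : ℂ → ℝ,
          IsHarmonicOn f (rectangle a b c) →
          ContinuousOn f (closure (rectangle a b c)) →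
          (∫ x in a..b, max (f (x : ℂ)) 0) ≤ M →
          (∀ z ∈ rectangle a b c, -(M * z.im ^ (-α)) ≤ f z) →
          (∀ z ∈ rectangle a b c, d₀ < z.im → f z ≤ M) →
          -C ≤ ∫ x in (a + δ)..(b - δ), min (f (x : ℂ)) 0 := by
  refine ⟨c / 2, by positivity, by linarith, fun M hM δ hδ hδab => ?_⟩
  set p := a + δ / 2 with hp
  set q := b - δ / 2 with hq
  have hap : a < p := by linarith
  have hqb : q < b := by linarith
  have hpq : p ≤ q := by linarith
  let ψ : ContDiffBump ((a + b) / 2) :=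
    ⟨(b - a) / 2 - δ, (b - a) / 2 - 3 * δ / 4, by linarith, by linarith⟩
  have hsupp : tsupport ψ ⊆ Ioo p q := by
    rw [ψ.tsupport_eq, Real.closedBall_eq_Icc]
    exact Icc_subset_Ioo (by simp only [ψ]; linarith) (by simp only [ψ]; linarith)
  have hone : ∀ x ∈ Icc (a + δ) (b - δ), ψ x = 1 := by
    refine fun x hx => ψ.one_of_mem_closedBall ?_
    rw [Real.closedBall_eq_Icc]
    exact ⟨by simp only [ψ]; linarith [hx.1], by simp only [ψ]; linarith [hx.2]⟩
  obtain ⟨N, hN, K, hK, hbound⟩ := exists_abs_le_rpow (α := α) hc hM hap hqb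
  obtain ⟨C, hC, hC'⟩ := exists_abs_integral_slice_le hc hap hpq hqb hN hK N 0 (by simp) ψ
    ψ.contDiff hsupp
  refine ⟨C + M, by positivity, fun f hf hcont hplus hlow hup => ?_⟩
  have hslice := hC' f hf (hbound f hf hlow hup hα)
  have hbdry : |∫ x in p..q, f x * ψ x| ≤ C := by
    have hlim := (tendsto_integral_slice hab hc hap.le hpq hqb.le hcont ψ.continuous).abs
    have hlim' : Tendsto (fun y : ℝ => C * (1 + y ^ (1 / 2 - 2 * (0 : ℕ) : ℝ))) (𝓝[>] 0)
        (𝓝 (C * (1 + 0 ^ (1 / 2 - 2 * (0 : ℕ) : ℝ)))) := by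
      refine Tendsto.mono_left ?_ nhdsWithin_le_nhds
      exact ((Real.continuousAt_rpow_const 0 _ (Or.inr (by norm_num))).tendsto.const_add
        1).const_mul C
    have := le_of_tendsto_of_tendsto hlim hlim' (by
      filter_upwards [Ioo_mem_nhdsGT hc] with y hy using hslice y hy)
    rwa [Real.zero_rpow (by norm_num), add_zero, mul_one] at this
  have hfc : ContinuousOn (fun x : ℝ => f x) (Icc a b) := by
    refine hcont.comp (by fun_prop) fun x hx => ?_
    simpa using (add_mul_I_mem_closure_rectangle hab hc).2 ⟨hx, ⟨le_rfl, hc.le⟩⟩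
  have hmin : ContinuousOn (fun x : ℝ => min (f x) 0) (Icc a b) :=
    (continuous_id.min continuous_const).comp_continuousOn hfc
  have hmax : ContinuousOn (fun x : ℝ => max (f x) 0) (Icc a b) :=
    (continuous_id.max continuous_const).comp_continuousOn hfc
  have hii : ∀ {h : ℝ → ℝ} {s t : ℝ}, ContinuousOn h (Icc a b) → a ≤ s → s ≤ t → t ≤ b →
      IntervalIntegrable h volume s t := fun hh h1 h2 h3 =>
    (hh.mono (Icc_subset_Icc h1 h3)).intervalIntegrable_of_Icc h2
  have hmulψ : ∀ {h : ℝ → ℝ}, ContinuousOn h (Icc a b) →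
      ContinuousOn (fun x => h x * ψ x) (Icc a b) := fun hh => hh.mul ψ.continuous.continuousOn
  have h1 : ∫ x in p..q, max (f x) 0 * ψ x ≤ M := by
    calc ∫ x in p..q, max (f x) 0 * ψ x ≤ ∫ x in p..q, max (f x) 0 :=
          intervalIntegral.integral_mono_on hpq (hii (hmulψ hmax) hap.le hpq hqb.le)
            (hii hmax hap.le hpq hqb.le) fun x _ =>
              mul_le_of_le_one_right (le_max_right _ _) ψ.le_one
      _ ≤ ∫ x in a..b, max (f x) 0 :=
          intervalIntegral.integral_mono_interval hap.le hpq hqb.le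
            (ae_of_all _ fun x => le_max_right _ _) (hii hmax le_rfl hab.le le_rfl)
      _ ≤ M := hplus
  have h2 : ∫ x in p..q, min (f x) 0 * ψ x =
      (∫ x in p..q, f x * ψ x) - ∫ x in p..q, max (f x) 0 * ψ x := by
    rw [← intervalIntegral.integral_sub (hii (hmulψ hfc) hap.le hpq hqb.le)
      (hii (hmulψ hmax) hap.le hpq hqb.le)]
    refine intervalIntegral.integral_congr fun x _ => ?_
    have := min_add_max (f x) 0
    simp only [← sub_mul]
    congr 1
    linarith
  have h3 : ∫ x in p..q, min (f x) 0 * ψ x ≤ ∫ x in (a + δ)..(b - δ), min (f x) 0 := by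
    have h4 : ∫ x in (a + δ)..(b - δ), -(min (f x) 0 * ψ x) ≤
        ∫ x in p..q, -(min (f x) 0 * ψ x) :=
      intervalIntegral.integral_mono_interval (by linarith) (by linarith) (by linarith)
        (ae_of_all _ fun x => neg_nonneg.2
          (mul_nonpos_of_nonpos_of_nonneg (min_le_right _ _) ψ.nonneg))
        (hii (hmulψ hmin).neg hap.le hpq hqb.le)
    have h5 : ∫ x in (a + δ)..(b - δ), min (f x) 0 * ψ x =
        ∫ x in (a + δ)..(b - δ), min (f x) 0 := by
      refine intervalIntegral.integral_congr fun x hx => ?_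
      rw [uIcc_of_le (by linarith)] at hx
      simp [hone x hx]
    rw [intervalIntegral.integral_neg, intervalIntegral.integral_neg, h5] at h4
    linarith
  linarith [(abs_le.1 hbdry).1]
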